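/- There exist constants C, c > 0 such that: (i) for all integers y ≥ 0, x ≤ y, ℓ ≥ 0 and n ≥ 1, P_x(𝔇_{β_n} = y + ℓ) ≤ C e^{−cℓ} P_x(𝔇_{β_n} = y); and (ii) for all integers y ≤ 0, all x ∈ ℤ, all ℓ ≥ 0 and n ≥ 1, P_x(𝔇_{β_n} = y − ℓ) ≤ C e^{−cℓ} P_x(𝔇_{β_n} = y). -/

import Mathlib

open MeasureTheory Filter ProbabilityTheory

noncomputable section

/-- One-step transition probability of the urn discrepancy chain with parameter `lam`:
from state `i`, jump to `i+1` with probability `lam^(2i-1)/(1+lam^(2i-1))` and to `i-1`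
with probability `1/(1+lam^(2i-1))`. -/
def urnStep (lam : ℝ) (i j : ℤ) : ℝ :=
  if j = i + 1 then lam ^ (2 * i - 1) / (1 + lam ^ (2 * i - 1))
  else if j = i - 1 then 1 / (1 + lam ^ (2 * i - 1))
  else 0

/-- `P` is the family of laws (indexed by the starting point) of the urn discrepancy
chain with parameter `lam`, characterized by its cylinder probabilities. -/
def IsUrnChain (lam : ℝ) (P : ℤ → Measure (ℕ → ℤ)) : Prop :=
  (∀ x, IsProbabilityMeasure (P x)) ∧
    ∀ (x : ℤ) (n : ℕ) (p : ℕ → ℤ),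
      (P x {ω | ∀ i ≤ n, ω i = p i}).toReal =
        (if p 0 = x then (1 : ℝ) else 0) *
          ∏ i ∈ Finset.range n, urnStep lam (p i) (p (i + 1))

/-- Number of down-steps of the path `ω` during the time interval `[1, j]`. -/
def downCount (ω : ℕ → ℤ) (j : ℕ) : ℕ :=
  ((Finset.Icc 1 j).filter fun ℓ => ω ℓ = ω (ℓ - 1) - 1).card

/-- `betaTime ω i` is the time of the `i`-th down-step of the path `ω`. -/
def betaTime (ω : ℕ → ℤ) (i : ℕ) : ℕ :=
  sInf {j | 1 ≤ j ∧ downCount ω j = i}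

/-- The probability distribution `π(x) = lam^(x²) / Σ_y lam^(y²)` on `ℤ`. -/
def urnPi (lam : ℝ) (x : ℤ) : ℝ :=
  lam ^ (x ^ 2) / ∑' y : ℤ, lam ^ (y ^ 2)

section Step

variable {lam : ℝ}

theorem urnStep_up (i : ℤ) :
    urnStep lam i (i + 1) = lam ^ (2 * i - 1) / (1 + lam ^ (2 * i - 1)) := by
  simp [urnStep]

theorem urnStep_down (i : ℤ) : urnStep lam i (i - 1) = 1 / (1 + lam ^ (2 * i - 1)) := by
  have h : i - 1 ≠ i + 1 := by omega
  simp [urnStep, h]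

theorem urnStep_of_not_adjacent {i j : ℤ} (h₁ : j ≠ i + 1) (h₂ : j ≠ i - 1) :
    urnStep lam i j = 0 := by
  simp [urnStep, h₁, h₂]

theorem urnStep_nonneg (hlam : 0 < lam) (i j : ℤ) : 0 ≤ urnStep lam i j := by
  have : 0 < lam ^ (2 * i - 1) := zpow_pos hlam _
  unfold urnStep
  split_ifs <;> positivity

theorem urnStep_up_eq_mul_down (i : ℤ) :
    urnStep lam i (i + 1) = lam ^ (2 * i - 1) * urnStep lam i (i - 1) := by
  rw [urnStep_up, urnStep_down, mul_one_div]

theorem urnStep_up_le (hlam : 0 < lam) (i : ℤ) :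
    urnStep lam i (i + 1) ≤ lam ^ (2 * i - 1) := by
  have : 0 < lam ^ (2 * i - 1) := zpow_pos hlam _
  rw [urnStep_up]
  exact div_le_self this.le (by linarith)

end Step

section Chain

variable {lam : ℝ} {P : ℤ → Measure (ℕ → ℤ)}

theorem measurableSet_coord_eq (k : ℕ) (w : ℤ) : MeasurableSet {ω : ℕ → ℤ | ω k = w} :=
  (measurable_pi_apply (X := fun _ : ℕ => ℤ) k) (measurableSet_singleton w)

/-- The Markov property at a fixed time. -/
theorem IsUrnChain.measure_succ (hP : IsUrnChain lam P) (hlam : 0 < lam)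
    (x : ℤ) (k : ℕ) (w w' : ℤ) :
    P x {ω | ω k = w ∧ ω (k + 1) = w'} =
      ENNReal.ofReal (urnStep lam w w') * P x {ω | ω k = w} := by
  have := hP.1 x
  let r : (ℕ → ℤ) → (Fin (k + 1) → ℤ) := fun ω i => ω i
  have hr : Measurable r := measurable_pi_lambda _ fun i => measurable_pi_apply _
  let S : Set (Fin (k + 1) → ℤ) := {p | p (Fin.last k) = w}
  have hS : r ⁻¹' S = {ω | ω k = w} := by ext ω; simp [r, S]
  have hB := measurableSet_coord_eq (k + 1) w'
  have h₁ := tsum_measure_preimage_singleton (μ := P x) (Set.to_countable S) (f := r)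
    fun y _ => hr (measurableSet_singleton y)
  have h₂ := tsum_measure_preimage_singleton (μ := (P x).restrict {ω | ω (k + 1) = w'})
    (Set.to_countable S) (f := r) fun y _ => hr (measurableSet_singleton y)
  rw [hS] at h₁ h₂
  rw [Measure.restrict_apply (measurableSet_coord_eq k w)] at h₂
  change P x ({ω | ω k = w} ∩ {ω | ω (k + 1) = w'}) = _
  rw [← h₁, ← h₂, ← ENNReal.tsum_mul_left]
  refine tsum_congr fun ⟨p, hp⟩ => ?_
  rw [Measure.restrict_apply (hr (measurableSet_singleton p))]
  let e : ℕ → ℤ := fun i => if h : i < k + 1 then p ⟨i, h⟩ else w'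
  have hek : e k = w := (dif_pos k.lt_succ_self).trans hp
  have hek' : e (k + 1) = w' := by simp [e]
  have hr' : r ⁻¹' {p} = {ω | ∀ i ≤ k, ω i = e i} := by
    ext ω
    simp only [Set.mem_preimage, Set.mem_singleton_iff, Set.mem_ofPred_eq, r, funext_iff,
      Fin.forall_iff]
    refine forall_congr' fun i => ?_
    by_cases hi : i < k + 1
    · simp [e, hi, Nat.lt_succ_iff.1 hi]
    · simp [hi, show ¬ i ≤ k by omega]
  have hr'' : r ⁻¹' {p} ∩ {ω | ω (k + 1) = w'} = {ω | ∀ i ≤ k + 1, ω i = e i} := by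
    rw [hr']
    ext ω
    simp only [Set.mem_inter_iff, Set.mem_ofPred_eq]
    constructor
    · rintro ⟨h, h'⟩ i hi
      rcases Nat.le_succ_iff.1 hi with hi | rfl
      · exact h i hi
      · rw [hek']; exact h'
    · exact fun h => ⟨fun i hi => h i (by omega), (h _ le_rfl).trans hek'⟩
  rw [hr'', hr', ← ENNReal.toReal_eq_toReal_iff' (measure_ne_top _ _)
    (ENNReal.mul_ne_top ENNReal.ofReal_ne_top (measure_ne_top _ _)), ENNReal.toReal_mul,
    ENNReal.toReal_ofReal (urnStep_nonneg hlam _ _), hP.2, hP.2, Finset.prod_range_succ, hek, hek']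
  ring

theorem IsUrnChain.real_succ (hP : IsUrnChain lam P) (hlam : 0 < lam)
    (x : ℤ) (k : ℕ) (w w' : ℤ) :
    (P x).real {ω | ω k = w ∧ ω (k + 1) = w'} =
      urnStep lam w w' * (P x).real {ω | ω k = w} := by
  rw [measureReal_def, hP.measure_succ hlam, ENNReal.toReal_mul,
    ENNReal.toReal_ofReal (urnStep_nonneg hlam _ _), measureReal_def]

theorem IsUrnChain.ae_zero (hP : IsUrnChain lam P) (x : ℤ) : ∀ᵐ ω ∂P x, ω 0 = x := by
  have := hP.1 x
  have h := hP.2 x 0 fun _ => x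
  simp only [Nat.le_zero, forall_eq, Finset.range_zero, Finset.prod_empty, if_true, mul_one] at h
  have h' : P x {ω | ω 0 = x} = 1 := by
    rw [← ENNReal.toReal_eq_one_iff]; exact h
  exact (prob_compl_eq_zero_iff (measurableSet_coord_eq 0 x)).2 h'

theorem IsUrnChain.ae_adjacent (hP : IsUrnChain lam P) (hlam : 0 < lam) (x : ℤ) :
    ∀ᵐ ω ∂P x, ∀ k : ℕ, ω (k + 1) = ω k + 1 ∨ ω (k + 1) = ω k - 1 := by
  refine ae_all_iff.2 fun k => ?_
  have h : ∀ᵐ ω ∂P x, ∀ w w' : ℤ, w' ≠ w + 1 → w' ≠ w - 1 → ¬ (ω k = w ∧ ω (k + 1) = w') := by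
    refine ae_all_iff.2 fun w => ae_all_iff.2 fun w' => ?_
    by_cases h₁ : w' = w + 1
    · simp [h₁]
    by_cases h₂ : w' = w - 1
    · simp [h₂]
    have h := hP.measure_succ hlam x k w w'
    rw [urnStep_of_not_adjacent h₁ h₂, ENNReal.ofReal_zero, zero_mul] at h
    filter_upwards [measure_eq_zero_iff_ae_notMem.1 h] with ω hω _ _ using hω
  filter_upwards [h] with ω hω
  by_contra! hc
  exact hω _ _ hc.1 hc.2 ⟨rfl, rfl⟩

/-- Almost surely there are infinitely many down-steps. -/
theorem IsUrnChain.ae_exists_down (hP : IsUrnChain lam P) (hlam : lam ∈ Set.Ioo (0 : ℝ) 1)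
    (x : ℤ) : ∀ᵐ ω ∂P x, ∀ N : ℕ, ∃ k ≥ N, ω (k + 1) = ω k - 1 := by
  have := hP.1 x
  refine ae_all_iff.2 fun N => ?_
  have h : ∀ᵐ ω ∂P x, ∀ w : ℤ, ¬ ∀ j : ℕ, ω (N + j) = w + j := by
    refine ae_all_iff.2 fun w => ?_
    refine measure_eq_zero_iff_ae_notMem.1 (?_ : P x {ω | ∀ j : ℕ, ω (N + j) = w + j} = 0)
    rw [← measureReal_eq_zero_iff]
    refine le_antisymm ?_ measureReal_nonneg
    have hbound : ∀ j : ℕ, (P x).real {ω | ∀ j : ℕ, ω (N + j) = w + j} ≤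
        lam ^ (2 * w - 1) * (lam ^ 2) ^ j := fun j => by
      calc (P x).real {ω | ∀ j : ℕ, ω (N + j) = w + j}
          ≤ (P x).real {ω | ω (N + j) = w + j ∧ ω (N + j + 1) = w + j + 1} := by
            refine measureReal_mono fun ω hω => ⟨hω j, ?_⟩
            have := hω (j + 1)
            push_cast at this
            rw [add_assoc, this]; ring
        _ = urnStep lam (w + j) (w + j + 1) * (P x).real {ω | ω (N + j) = w + j} :=
            hP.real_succ hlam.1 x _ _ _
        _ ≤ lam ^ (2 * (w + j) - 1) * 1 :=
            mul_le_mul (urnStep_up_le hlam.1 _) measureReal_le_one measureReal_nonneg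
              (zpow_pos hlam.1 _).le
        _ = lam ^ (2 * w - 1) * (lam ^ 2) ^ j := by
            rw [mul_one, ← pow_mul, ← zpow_natCast lam (2 * j), ← zpow_add₀ hlam.1.ne']
            push_cast
            congr 1; ring
    have hlim : Tendsto (fun j : ℕ => lam ^ (2 * w - 1) * (lam ^ 2) ^ j) atTop (nhds 0) := by
      simpa using (tendsto_pow_atTop_nhds_zero_of_lt_one (sq_nonneg lam)
        (pow_lt_one₀ hlam.1.le hlam.2 two_ne_zero)).const_mul (lam ^ (2 * w - 1))
    exact ge_of_tendsto' hlim hbound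
  filter_upwards [h, hP.ae_adjacent hlam.1 x] with ω hω hadj
  by_contra! hc
  refine hω (ω N) fun j => ?_
  induction j with
  | zero => simp
  | succ j ih =>
    rcases hadj (N + j) with h | h
    · rw [← add_assoc, h, ih]; push_cast; ring
    · exact absurd h (hc _ (by omega))

end Chain

section BetaTime

theorem downCount_succ (ω : ℕ → ℤ) (k : ℕ) :
    downCount ω (k + 1) = downCount ω k + if ω (k + 1) = ω k - 1 then 1 else 0 := by
  unfold downCount
  rw [← Finset.insert_Icc_right_eq_Icc_add_one (by omega), Finset.filter_insert]
  split_ifs with h₁ h₂ h₂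
  · rw [Finset.card_insert_of_notMem (by simp)]
  · exact absurd h₁ h₂
  · exact absurd h₂ h₁
  · rfl

theorem downCount_zero (ω : ℕ → ℤ) : downCount ω 0 = 0 := by simp [downCount]

theorem downCount_mono (ω : ℕ → ℤ) : Monotone (downCount ω) :=
  monotone_nat_of_le_succ fun k => by rw [downCount_succ]; exact Nat.le_add_right _ _

variable {ω : ℕ → ℤ}

theorem coord_eq_sub_downCount
    (hadj : ∀ k : ℕ, ω (k + 1) = ω k + 1 ∨ ω (k + 1) = ω k - 1) (k : ℕ) :
    ω k = ω 0 + k - 2 * downCount ω k := by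
  induction k with
  | zero => simp [downCount_zero]
  | succ k ih =>
    rw [downCount_succ]
    split_ifs with h
    · rw [h]; push_cast; omega
    · have := (hadj k).resolve_right h
      push_cast; omega

theorem exists_downCount_eq (hdown : ∀ N : ℕ, ∃ k ≥ N, ω (k + 1) = ω k - 1) (n : ℕ) :
    ∃ k, downCount ω k = n := by
  induction n with
  | zero => exact ⟨0, downCount_zero ω⟩
  | succ n ih =>
    obtain ⟨N, hN⟩ := ih
    have hex := hdown N
    classical
    obtain ⟨hk, hk'⟩ := Nat.find_spec hex
    refine ⟨Nat.find hex + 1, ?_⟩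
    have hconst : ∀ j, N + j ≤ Nat.find hex → downCount ω (N + j) = n := by
      intro j
      induction j with
      | zero => exact fun _ => hN
      | succ j ih =>
        intro hj
        have hnot : ω (N + j + 1) ≠ ω (N + j) - 1 := fun h =>
          Nat.find_min hex (m := N + j) (by omega) ⟨by omega, h⟩
        rw [← add_assoc, downCount_succ, ih (by omega), if_neg hnot, add_zero]
    have := hconst (Nat.find hex - N) (by omega)
    rw [Nat.add_sub_cancel' hk] at this
    rw [downCount_succ, this, if_pos hk']

theorem betaTime_eq_succ {n k : ℕ} (h₁ : downCount ω (k + 1) = n)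
    (h₂ : ω (k + 1) = ω k - 1) : betaTime ω n = k + 1 := by
  refine le_antisymm (Nat.sInf_le ⟨by omega, h₁⟩) (le_csInf ⟨k + 1, by omega, h₁⟩ ?_)
  rintro j ⟨-, hj⟩
  by_contra! hlt
  have := downCount_mono ω (Nat.lt_succ_iff.1 hlt)
  rw [downCount_succ, if_pos h₂] at h₁
  omega

theorem exists_betaTime_eq_succ (hdown : ∀ N : ℕ, ∃ k ≥ N, ω (k + 1) = ω k - 1) {n : ℕ}
    (hn : 1 ≤ n) : ∃ k, betaTime ω n = k + 1 ∧ downCount ω (k + 1) = n ∧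
      ω (k + 1) = ω k - 1 := by
  classical
  have hex := exists_downCount_eq hdown n
  have hspec := Nat.find_spec hex
  obtain ⟨k, hk⟩ : ∃ k, Nat.find hex = k + 1 := by
    refine Nat.exists_eq_succ_of_ne_zero fun h => ?_
    rw [h, downCount_zero] at hspec
    omega
  rw [hk] at hspec
  have hstep : ω (k + 1) = ω k - 1 := by
    by_contra hne
    rw [downCount_succ, if_neg hne] at hspec
    exact Nat.find_min hex (m := k) (by omega) hspec
  exact ⟨k, betaTime_eq_succ hspec hstep, hspec, hstep⟩

/-- The position at the `n`-th down-step determines its time. -/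
theorem coord_betaTime_eq_iff
    (hadj : ∀ k : ℕ, ω (k + 1) = ω k + 1 ∨ ω (k + 1) = ω k - 1)
    (hdown : ∀ N : ℕ, ∃ k ≥ N, ω (k + 1) = ω k - 1) {n : ℕ} (hn : 1 ≤ n) (z : ℤ) :
    ω (betaTime ω n) = z ↔ ∃ k : ℕ, (k : ℤ) = z - ω 0 + 2 * n - 1 ∧
      ω k = z + 1 ∧ ω (k + 1) = z := by
  constructor
  · rintro rfl
    obtain ⟨k, hk, hcount, hstep⟩ := exists_betaTime_eq_succ hdown hn
    have := coord_eq_sub_downCount hadj (k + 1)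
    rw [hcount] at this
    rw [hk]
    refine ⟨k, ?_, ?_, rfl⟩
    · push_cast at this; omega
    · omega
  · rintro ⟨k, hk, hk₁, hk₂⟩
    have := coord_eq_sub_downCount hadj (k + 1)
    rw [betaTime_eq_succ (k := k) (by push_cast at this; omega) (by omega), hk₂]

end BetaTime

section Marginal

variable {lam : ℝ} {P : ℤ → Measure (ℕ → ℤ)}

/-- The one-time marginals of `P x`, extended by `0` to negative times. -/
def urnMarginal (P : ℤ → Measure (ℕ → ℤ)) (x k w : ℤ) : ℝ :=
  if 0 ≤ k then (P x).real {ω | ω k.toNat = w} else 0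

theorem urnMarginal_nonneg (x k w : ℤ) : 0 ≤ urnMarginal P x k w := by
  unfold urnMarginal
  split_ifs
  exacts [measureReal_nonneg, le_rfl]

theorem IsUrnChain.marginal_succ (hP : IsUrnChain lam P) (hlam : 0 < lam) (x w : ℤ) {k : ℤ}
    (hk : 0 ≤ k) :
    urnMarginal P x (k + 1) w =
      urnStep lam (w - 1) w * urnMarginal P x k (w - 1) +
        urnStep lam (w + 1) w * urnMarginal P x k (w + 1) := by
  have := hP.1 x
  lift k to ℕ using hk
  have h : ((k : ℤ) + 1).toNat = k + 1 := by omega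
  simp only [urnMarginal, h, Int.toNat_natCast, Int.natCast_nonneg, if_true,
    show (0 : ℤ) ≤ (k : ℤ) + 1 by omega]
  rw [← hP.real_succ hlam, ← hP.real_succ hlam, ← measureReal_union]
  · refine measureReal_congr ?_
    filter_upwards [hP.ae_adjacent hlam x] with ω hω
    refine propext ?_
    change ω (k + 1) = w ↔
      (ω k = w - 1 ∧ ω (k + 1) = w) ∨ (ω k = w + 1 ∧ ω (k + 1) = w)
    have := hω k
    omega
  · exact Set.disjoint_left.2 fun ω h₁ h₂ => by
      have := h₁.1; have := h₂.1; omega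
  · exact (measurableSet_coord_eq _ _).inter (measurableSet_coord_eq _ _)

theorem IsUrnChain.marginal_eq_zero (hP : IsUrnChain lam P) (hlam : 0 < lam) (x : ℤ) {k w : ℤ}
    (h : x + k < w) : urnMarginal P x k w = 0 := by
  by_cases hk : 0 ≤ k
  · rw [urnMarginal, if_pos hk]
    refine (measureReal_congr (t := ∅) ?_).trans (by simp)
    refine eventuallyEq_empty.2 ?_
    filter_upwards [hP.ae_adjacent hlam x, hP.ae_zero x] with ω hω hω₀ hw
    have := coord_eq_sub_downCount hω k.toNat
    change ω k.toNat = w at hw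
    omega
  · rw [urnMarginal, if_neg hk]

/-- The candidate mass function of the position at the `n`-th down-step. -/
def urnBeta (lam : ℝ) (P : ℤ → Measure (ℕ → ℤ)) (x : ℤ) (n : ℕ) (z : ℤ) : ℝ :=
  urnStep lam (z + 1) z * urnMarginal P x (z - x + 2 * n - 1) (z + 1)

theorem IsUrnChain.real_betaTime_eq (hP : IsUrnChain lam P) (hlam : lam ∈ Set.Ioo (0 : ℝ) 1)
    (x : ℤ) {n : ℕ} (hn : 1 ≤ n) (z : ℤ) :
    (P x {ω | ω (betaTime ω n) = z}).toReal = urnBeta lam P x n z := by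
  have hiff : ∀ᵐ ω ∂P x, ω (betaTime ω n) = z ↔ ∃ k : ℕ, (k : ℤ) = z - x + 2 * n - 1 ∧
      ω k = z + 1 ∧ ω (k + 1) = z := by
    filter_upwards [hP.ae_zero x, hP.ae_adjacent hlam.1 x, hP.ae_exists_down hlam x]
      with ω h₀ hadj hdown
    rw [coord_betaTime_eq_iff hadj hdown hn, h₀]
  unfold urnBeta urnMarginal
  change (P x).real _ = _
  rw [measureReal_congr (t := {ω | ∃ k : ℕ, (k : ℤ) = z - x + 2 * n - 1 ∧
      ω k = z + 1 ∧ ω (k + 1) = z}) (by filter_upwards [hiff] with ω hω using propext hω)]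
  generalize z - x + 2 * n - 1 = K
  split_ifs with hK
  · lift K to ℕ using hK
    rw [Int.toNat_natCast, ← hP.real_succ hlam.1]
    simp
  · have : ∀ k : ℕ, (k : ℤ) ≠ K := fun k => by omega
    simp [this]

theorem urnBeta_nonneg (hlam : 0 < lam) (x : ℤ) (n : ℕ) (z : ℤ) : 0 ≤ urnBeta lam P x n z :=
  mul_nonneg (urnStep_nonneg hlam _ _) (urnMarginal_nonneg _ _ _)

theorem IsUrnChain.beta_zero (hP : IsUrnChain lam P) (hlam : 0 < lam) (x z : ℤ) :
    urnBeta lam P x 0 z = 0 := by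
  rw [urnBeta, hP.marginal_eq_zero hlam x (by push_cast; omega), mul_zero]

theorem IsUrnChain.beta_succ (hP : IsUrnChain lam P) (hlam : 0 < lam) (x : ℤ) (n : ℕ) {z : ℤ}
    (hz : x ≤ z + 2 * n) :
    urnBeta lam P x (n + 1) z = urnStep lam (z + 1) z *
      (urnBeta lam P x n (z + 1) + lam ^ (2 * z - 1) * urnBeta lam P x (n + 1) (z - 1)) := by
  have h := hP.marginal_succ hlam x (z + 1) (k := z - x + 2 * n) (by omega)
  have hup := urnStep_up_eq_mul_down (lam := lam) z
  simp only [urnBeta]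
  rw [show z - x + 2 * ((n + 1 : ℕ) : ℤ) - 1 = z - x + 2 * n + 1 by push_cast; ring,
    show z - 1 - x + 2 * ((n + 1 : ℕ) : ℤ) - 1 = z - x + 2 * n by push_cast; ring,
    show z + 1 - x + 2 * (n : ℤ) - 1 = z - x + 2 * n by ring, h,
    show z + 1 - 1 = z by ring, show z - 1 + 1 = z by ring, hup]
  ring

theorem IsUrnChain.le_beta_succ (hP : IsUrnChain lam P) (hlam : 0 < lam) (x : ℤ) (n : ℕ) (z : ℤ) :
    urnStep lam (z + 1) z *
      (urnBeta lam P x n (z + 1) + lam ^ (2 * z - 1) * urnBeta lam P x (n + 1) (z - 1)) ≤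
      urnBeta lam P x (n + 1) z := by
  by_cases hz : x ≤ z + 2 * n
  · exact (hP.beta_succ hlam x n hz).ge
  · have h₁ : urnBeta lam P x n (z + 1) = 0 := by
      rw [urnBeta, urnMarginal, if_neg (by omega), mul_zero]
    have h₂ : urnBeta lam P x (n + 1) (z - 1) = 0 := by
      rw [urnBeta, urnMarginal, if_neg (by push_cast; omega), mul_zero]
    rw [h₁, h₂]
    simpa using urnBeta_nonneg hlam x (n + 1) z

theorem urnStep_add_one_mul (hlam : 0 < lam) (z : ℤ) :
    (1 + lam ^ (2 * z + 1)) * urnStep lam (z + 1) z = 1 := by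
  have h := urnStep_down (lam := lam) (z + 1)
  rw [show z + 1 - 1 = z by ring, show 2 * (z + 1) - 1 = 2 * z + 1 by ring] at h
  have : 0 < lam ^ (2 * z + 1) := zpow_pos hlam _
  rw [h]
  field_simp

theorem IsUrnChain.beta_add_one_le (hP : IsUrnChain lam P) (hlam : lam ∈ Set.Ioo (0 : ℝ) 1)
    (x : ℤ) (n : ℕ) : ∀ z : ℤ, x ≤ z → urnBeta lam P x n (z + 1) ≤
      lam ^ (2 * z + 1) * (1 + lam ^ (2 * z + 1)) / (1 - lam ^ 2) * urnBeta lam P x n z := by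
  have hsq : 0 < 1 - lam ^ 2 := by
    have := pow_lt_one₀ hlam.1.le hlam.2 two_ne_zero
    linarith
  induction n with
  | zero => intro z _; simp [hP.beta_zero hlam.1]
  | succ n ih =>
    intro z hz
    have hrec := hP.beta_succ hlam.1 x n (z := z + 1) (by omega)
    have hih := ih (z + 1) (by omega)
    have hle := hP.le_beta_succ hlam.1 x n z
    have hb := urnStep_add_one_mul hlam.1 z
    have hb' := urnStep_add_one_mul hlam.1 (z + 1)
    have hq : 0 < lam ^ (2 * z + 1) := zpow_pos hlam.1 _
    rw [show 2 * (z + 1) - 1 = 2 * z + 1 by ring, show z + 1 - 1 = z by ring] at hrec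
    rw [show 2 * (z + 1) + 1 = (2 * z + 1) + 2 by ring, zpow_add₀ hlam.1.ne',
      show lam ^ (2 : ℤ) = lam ^ 2 from zpow_ofNat lam 2] at hih hb'
    have hprev : 0 ≤ lam ^ (2 * z - 1) * urnBeta lam P x (n + 1) (z - 1) :=
      mul_nonneg (zpow_pos hlam.1 _).le (urnBeta_nonneg hlam.1 _ _ _)
    have hF : 0 ≤ urnBeta lam P x (n + 1) z := urnBeta_nonneg hlam.1 _ _ _
    have hstep : 0 ≤ urnStep lam (z + 1 + 1) (z + 1) := urnStep_nonneg hlam.1 _ _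
    generalize lam ^ (2 * z + 1) = q at *
    generalize urnStep lam (z + 1) z = b at *
    generalize urnStep lam (z + 1 + 1) (z + 1) = b' at *
    generalize urnBeta lam P x (n + 1) z = F at *
    generalize urnBeta lam P x n (z + 1) = G at *
    generalize lam ^ (2 * z - 1) * urnBeta lam P x (n + 1) (z - 1) = E at *
    have hGF : G ≤ (1 + q) * F := by
      have h := mul_le_mul_of_nonneg_left hle (by linarith : 0 ≤ 1 + q)
      rw [← mul_assoc, hb, one_mul] at h
      linarith
    have hb₁ : b' ≤ 1 := by
      have : 0 ≤ q * lam ^ 2 * b' := by positivity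
      nlinarith
    have hd : q * lam ^ 2 / (1 - lam ^ 2) + q = q / (1 - lam ^ 2) := by
      field_simp; ring
    rw [hrec]
    calc _ ≤ b' * (q * lam ^ 2 * (1 + q * lam ^ 2) / (1 - lam ^ 2) * ((1 + q) * F) + q * F) := by
          gcongr
          refine hih.trans ?_
          gcongr
      _ = q * lam ^ 2 / (1 - lam ^ 2) * ((1 + q) * F) * ((1 + q * lam ^ 2) * b') + b' * (q * F) := by
          ring
      _ ≤ q * lam ^ 2 / (1 - lam ^ 2) * ((1 + q) * F) + (1 + q) * (q * F) := by
          rw [hb', mul_one]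
          gcongr
          linarith
      _ = (q * lam ^ 2 / (1 - lam ^ 2) + q) * ((1 + q) * F) := by ring
      _ = _ := by rw [hd]; ring

theorem IsUrnChain.beta_sub_one_le (hP : IsUrnChain lam P) (hlam : lam ∈ Set.Ioo (0 : ℝ) 1)
    (x : ℤ) (n : ℕ) (z : ℤ) : urnBeta lam P x (n + 1) (z - 1) ≤
      (lam ^ (1 - 2 * z) + lam ^ 2) * urnBeta lam P x (n + 1) z := by
  have hle := hP.le_beta_succ hlam.1 x n z
  have hG : 0 ≤ urnBeta lam P x n (z + 1) := urnBeta_nonneg hlam.1 _ _ _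
  have hb := urnStep_add_one_mul hlam.1 z
  have hq : 0 < lam ^ (1 - 2 * z) := zpow_pos hlam.1 _
  have hr : 0 < lam ^ (2 * z + 1) := zpow_pos hlam.1 _
  have hqp : lam ^ (1 - 2 * z) * lam ^ (2 * z - 1) = 1 := by
    rw [← zpow_add₀ hlam.1.ne', show 1 - 2 * z + (2 * z - 1) = 0 by ring, zpow_zero]
  have hqr : lam ^ (1 - 2 * z) * lam ^ (2 * z + 1) = lam ^ 2 := by
    rw [← zpow_add₀ hlam.1.ne', show 1 - 2 * z + (2 * z + 1) = 2 by ring, zpow_ofNat]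
  have h := mul_le_mul_of_nonneg_left hle
    (by positivity : 0 ≤ lam ^ (1 - 2 * z) * (1 + lam ^ (2 * z + 1)))
  calc urnBeta lam P x (n + 1) (z - 1)
      ≤ lam ^ (1 - 2 * z) * urnBeta lam P x n (z + 1) + urnBeta lam P x (n + 1) (z - 1) :=
        le_add_of_nonneg_left (by positivity)
    _ = lam ^ (1 - 2 * z) * (1 + lam ^ (2 * z + 1)) * (urnStep lam (z + 1) z *
        (urnBeta lam P x n (z + 1) + lam ^ (2 * z - 1) * urnBeta lam P x (n + 1) (z - 1))) := by
        linear_combination (-urnBeta lam P x (n + 1) (z - 1)) * hqp -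
          lam ^ (1 - 2 * z) * (urnBeta lam P x n (z + 1) +
            lam ^ (2 * z - 1) * urnBeta lam P x (n + 1) (z - 1)) * hb
    _ ≤ _ := h
    _ = _ := by rw [mul_add, mul_one, hqr]

end Marginal

/-- A sequence whose successive ratios are at most `lam * exp (A * lam ^ j)` decays like
`lam ^ ℓ`. -/
theorem le_exp_mul_of_ratio_le {lam A : ℝ} (hlam : lam ∈ Set.Ioo (0 : ℝ) 1) (hA : 0 ≤ A)
    {g : ℕ → ℝ} (hg₀ : 0 ≤ g 0)
    (hg : ∀ j, g (j + 1) ≤ lam * Real.exp (A * lam ^ j) * g j) (ℓ : ℕ) :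
    g ℓ ≤ Real.exp (A / (1 - lam)) * lam ^ ℓ * g 0 := by
  have hlam' : 0 < 1 - lam := by linarith [hlam.2]
  have h : g ℓ ≤ Real.exp (A * ((1 - lam ^ ℓ) / (1 - lam))) * lam ^ ℓ * g 0 := by
    induction ℓ with
    | zero => simp
    | succ ℓ ih =>
      have hpos := hlam.1
      refine (hg ℓ).trans ((mul_le_mul_of_nonneg_left ih (by positivity)).trans_eq ?_)
      have : A * ((1 - lam ^ (ℓ + 1)) / (1 - lam)) =
          A * lam ^ ℓ + A * ((1 - lam ^ ℓ) / (1 - lam)) := by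
        field_simp; ring
      rw [this, Real.exp_add]
      ring
  refine h.trans ?_
  have hpow : 0 < lam ^ ℓ := pow_pos hlam.1 _
  rw [div_eq_mul_one_div A]
  gcongr
  linarith

/-- Uniform exponential bounds on both tails of the law of `𝔇_{β_n}`. -/
theorem urn_beta_tails (lam : ℝ) (hlam : lam ∈ Set.Ioo (0 : ℝ) 1)
    (P : ℤ → Measure (ℕ → ℤ)) (hP : IsUrnChain lam P) :
    ∃ C > (0 : ℝ), ∃ c > (0 : ℝ),
      (∀ (y x ℓ : ℤ) (n : ℕ), 0 ≤ y → x ≤ y → 0 ≤ ℓ → 1 ≤ n →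
        (P x {ω | ω (betaTime ω n) = y + ℓ}).toReal ≤
          C * Real.exp (-c * (ℓ : ℝ)) * (P x {ω | ω (betaTime ω n) = y}).toReal) ∧
      (∀ (y x ℓ : ℤ) (n : ℕ), y ≤ 0 → 0 ≤ ℓ → 1 ≤ n →
        (P x {ω | ω (betaTime ω n) = y - ℓ}).toReal ≤
          C * Real.exp (-c * (ℓ : ℝ)) * (P x {ω | ω (betaTime ω n) = y}).toReal) := by
  have h0 := hlam.1
  have h1 := hlam.2
  have hsq : 0 < 1 - lam ^ 2 := by
    have := pow_lt_one₀ h0.le h1 two_ne_zero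
    linarith
  have hA : 1 ≤ 2 / (1 - lam ^ 2) := by
    rw [le_div_iff₀ hsq]
    nlinarith [sq_nonneg lam]
  set A := 2 / (1 - lam ^ 2) with hAdef
  have hexp : ∀ ℓ : ℕ, Real.exp (-(-Real.log lam) * ((ℓ : ℤ) : ℝ)) = lam ^ ℓ := fun ℓ => by
    rw [neg_neg, mul_comm, Int.cast_natCast, Real.exp_nat_mul, Real.exp_log h0]
  refine ⟨Real.exp (A / (1 - lam)), Real.exp_pos _, -Real.log lam,
    neg_pos.2 (Real.log_neg h0 h1), ?_, ?_⟩
  · intro y x ℓ n hy hxy hℓ hn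
    lift ℓ to ℕ using hℓ
    rw [hexp, hP.real_betaTime_eq hlam x hn, hP.real_betaTime_eq hlam x hn]
    have := le_exp_mul_of_ratio_le hlam (by linarith : 0 ≤ A)
      (g := fun j : ℕ => urnBeta lam P x n (y + j)) (urnBeta_nonneg h0 _ _ _) (fun j => ?_) ℓ
    · simpa using this
    · have hstep := hP.beta_add_one_le hlam x n (y + j) (by omega)
      push_cast
      rw [← add_assoc]
      refine hstep.trans (mul_le_mul_of_nonneg_right ?_ (urnBeta_nonneg h0 _ _ _))
      have hq : 0 < lam ^ (2 * (y + j)) := zpow_pos h0 _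
      have hqj : lam ^ (2 * (y + j)) ≤ lam ^ j := by
        rw [← zpow_natCast]
        exact zpow_le_zpow_right_of_le_one₀ h0 h1.le (by omega)
      have hq1 : lam ^ (2 * (y + j) + 1) ≤ 1 := zpow_le_one₀ h0 h1.le (by omega)
      calc lam ^ (2 * (y + j) + 1) * (1 + lam ^ (2 * (y + j) + 1)) / (1 - lam ^ 2)
          ≤ lam ^ (2 * (y + j) + 1) * 2 / (1 - lam ^ 2) := by
            gcongr; linarith
        _ = lam * (A * lam ^ (2 * (y + j))) := by
            rw [zpow_add_one₀ h0.ne', hAdef]; ring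
        _ ≤ lam * (A * lam ^ j) := by gcongr
        _ ≤ lam * Real.exp (A * lam ^ j) := by
            gcongr
            linarith [Real.add_one_le_exp (A * lam ^ j)]
  · intro y x ℓ n hy hℓ hn
    lift ℓ to ℕ using hℓ
    rw [hexp, hP.real_betaTime_eq hlam x hn, hP.real_betaTime_eq hlam x hn]
    obtain ⟨n, rfl⟩ := Nat.exists_eq_add_of_le' hn
    have := le_exp_mul_of_ratio_le hlam (by linarith : 0 ≤ A)
      (g := fun j : ℕ => urnBeta lam P x (n + 1) (y - j)) (urnBeta_nonneg h0 _ _ _)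
      (fun j => ?_) ℓ
    · simpa using this
    · have hstep := hP.beta_sub_one_le hlam x n (y - j)
      push_cast
      rw [← sub_sub]
      refine hstep.trans (mul_le_mul_of_nonneg_right ?_ (urnBeta_nonneg h0 _ _ _))
      have hqj : lam ^ (-(2 * (y - j))) ≤ lam ^ j := by
        rw [← zpow_natCast]
        exact zpow_le_zpow_right_of_le_one₀ h0 h1.le (by omega)
      have hj : 0 < lam ^ j := pow_pos h0 _
      calc lam ^ (1 - 2 * (y - j)) + lam ^ 2
          = lam * (lam ^ (-(2 * (y - j))) + lam) := by
            rw [sub_eq_add_neg, zpow_add₀ h0.ne', zpow_one]; ring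
        _ ≤ lam * (A * lam ^ j + 1) := by
            gcongr
            exact hqj.trans (le_mul_of_one_le_left hj.le hA)
        _ ≤ lam * Real.exp (A * lam ^ j) := by
            gcongr
            exact Real.add_one_le_exp _
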